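/- Let n and ℓ be positive integers with ℓ > 1 and such that n·ℓ is not a perfect square. Then the group S_{n,ℓ} is isomorphic to ℤ × ℤ/2ℤ. -/

import Mathlib

open Matrix

/-- A real number is an integer. -/
def IsIntR (x : ℝ) : Prop := ∃ m : ℤ, x = m

/-- `P(x,y) = [[y, ℓx],[x, y]]`. -/
def Pmat (ℓ : ℕ) (x y : ℝ) : Matrix (Fin 2) (Fin 2) ℝ :=
  !![y, (ℓ : ℝ) * x; x, y]

/-- `S_{n,ℓ}`: matrices `P(x,y)` with `x², y², xy/√n ∈ ℤ` and `y² − ℓx² = ±1`. -/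
def Snl (n ℓ : ℕ) : Set (Matrix (Fin 2) (Fin 2) ℝ) :=
  {M | ∃ x y : ℝ, M = Pmat ℓ x y ∧ IsIntR (x ^ 2) ∧ IsIntR (y ^ 2) ∧
       IsIntR (x * y / Real.sqrt n) ∧
       (y ^ 2 - ℓ * x ^ 2 = 1 ∨ y ^ 2 - ℓ * x ^ 2 = -1)}

/-- A group with a homomorphism to `ℝ` whose image is nontrivial and discrete and whose kernel is
generated by a central involution is isomorphic to `ℤ × ℤ/2ℤ`. -/
theorem nonempty_mulEquiv_int_prod_zmod_two {G : Type*} [Group G] (f : G →* Multiplicative ℝ)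
    (z : G) (hz : z * z = 1) (hz1 : z ≠ 1) (hc : ∀ g, Commute z g)
    (hker : ∀ g, f g = 1 → g = 1 ∨ g = z) (hfz : f z = 1) (δ : ℝ) (hδ : 0 < δ)
    (hd : ∀ g, 0 < (f g).toAdd → δ ≤ (f g).toAdd) (hnt : ∃ g, f g ≠ 1) :
    Nonempty (G ≃* Multiplicative (ℤ × ZMod 2)) := by
  obtain ⟨b, hb⟩ := AddSubgroup.cyclic_of_isolated_zero (H := f.range.toAddSubgroup')
    (a := δ) hδ (by
      rw [Set.disjoint_left]
      rintro x ⟨g, hg⟩ hx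
      have h := hd g
      rw [hg] at h
      exact absurd (h hx.1) (not_le.mpr hx.2))
  have hrange : ∀ x : ℝ, (∃ g, f g = Multiplicative.ofAdd x) ↔ ∃ k : ℤ, k • b = x := by
    intro x
    rw [← AddSubgroup.mem_closure_singleton, ← hb]
    rfl
  obtain ⟨u, hu⟩ := (hrange b).2 ⟨1, one_smul _ _⟩
  have hb0 : b ≠ 0 := by
    rintro rfl
    obtain ⟨g, hg⟩ := hnt
    obtain ⟨k, hk⟩ := (hrange (f g).toAdd).1 ⟨g, rfl⟩
    apply hg
    rw [smul_zero] at hk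
    exact Multiplicative.toAdd.injective hk.symm
  have hval : ∀ a b : ZMod 2, z ^ (a + b).val = z ^ a.val * z ^ b.val := by
    intro a b
    rw [ZMod.val_add, ← pow_add, ← pow_eq_pow_mod _ (by rw [pow_two, hz])]
  let φ : Multiplicative (ℤ × ZMod 2) →* G :=
    { toFun := fun p => u ^ p.toAdd.1 * z ^ p.toAdd.2.val
      map_one' := by simp
      map_mul' := by
        intro p q
        simp only [toAdd_mul, Prod.fst_add, Prod.snd_add, hval, _root_.zpow_add]
        have h : z ^ p.toAdd.2.val * u ^ q.toAdd.1 = u ^ q.toAdd.1 * z ^ p.toAdd.2.val :=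
          ((hc u).pow_left _).zpow_right _
        simp only [mul_assoc]
        rw [← mul_assoc (z ^ _) (u ^ _), h, mul_assoc] }
  have hfφ : ∀ (k : ℤ) (e : ℕ), f (u ^ k * z ^ e) = Multiplicative.ofAdd (k • b) := by
    intro k e
    rw [map_mul, map_zpow, map_pow, hfz, hu, one_pow, mul_one, ofAdd_zsmul]
  refine ⟨(MulEquiv.ofBijective φ ⟨?_, ?_⟩).symm⟩
  · rw [injective_iff_map_eq_one]
    intro p hp
    obtain ⟨k, e⟩ := p
    change u ^ k * z ^ e.val = 1 at hp
    have h := hfφ k e.val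
    rw [hp, map_one] at h
    have hk : k • b = 0 := (Multiplicative.ofAdd.injective h).symm
    obtain rfl : k = 0 := (smul_eq_zero.1 hk).resolve_right hb0
    have he : e = 0 := by
      rw [zpow_zero, one_mul] at hp
      by_contra he
      have hlt := ZMod.val_lt e
      have hne := (ZMod.val_ne_zero e).2 he
      rw [show e.val = 1 by omega, pow_one] at hp
      exact hz1 hp
    rw [he]
    rfl
  · intro g
    obtain ⟨k, hk⟩ := (hrange (f g).toAdd).1 ⟨g, rfl⟩
    have h : f ((u ^ k)⁻¹ * g) = 1 := by
      rw [map_mul, map_inv, map_zpow, hu, ← ofAdd_zsmul, hk, ofAdd_toAdd, inv_mul_cancel]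
    rcases hker _ h with h | h
    · refine ⟨Multiplicative.ofAdd (k, 0), ?_⟩
      change u ^ k * z ^ (0 : ZMod 2).val = g
      rw [ZMod.val_zero, pow_zero, mul_one]
      exact inv_mul_eq_one.1 h
    · refine ⟨Multiplicative.ofAdd (k, 1), ?_⟩
      change u ^ k * z ^ (1 : ZMod 2).val = g
      rw [ZMod.val_one, pow_one, ← h, mul_inv_cancel_left]

/-- The defining conditions of `Snl` on the parameters `x` and `y` of `Pmat`. -/
def SnlParam (n ℓ : ℕ) (x y : ℝ) : Prop :=
  IsIntR (x ^ 2) ∧ IsIntR (y ^ 2) ∧ IsIntR (x * y / Real.sqrt n) ∧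
    (y ^ 2 - ℓ * x ^ 2 = 1 ∨ y ^ 2 - ℓ * x ^ 2 = -1)

theorem Pmat_mul (ℓ : ℕ) (x y x' y' : ℝ) :
    Pmat ℓ x y * Pmat ℓ x' y' = Pmat ℓ (x * y' + y * x') (y * y' + ℓ * (x * x')) := by
  ext i j
  fin_cases i <;> fin_cases j <;> simp [Pmat, Matrix.mul_apply, Fin.sum_univ_two] <;> ring

theorem Pmat_zero_one (ℓ : ℕ) : Pmat ℓ 0 1 = 1 := by
  simp [Pmat, Matrix.one_fin_two]

theorem det_Pmat (ℓ : ℕ) (x y : ℝ) : (Pmat ℓ x y).det = y ^ 2 - ℓ * x ^ 2 := by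
  rw [Pmat, Matrix.det_fin_two_of]
  ring

theorem SnlParam.mul {n ℓ : ℕ} (hn : 0 < n) {x y x' y' : ℝ} (h : SnlParam n ℓ x y)
    (h' : SnlParam n ℓ x' y') :
    SnlParam n ℓ (x * y' + y * x') (y * y' + ℓ * (x * x')) := by
  obtain ⟨⟨a, ha⟩, ⟨b, hb⟩, ⟨c, hc⟩, hN⟩ := h
  obtain ⟨⟨a', ha'⟩, ⟨b', hb'⟩, ⟨c', hc'⟩, hN'⟩ := h'
  have hs : 0 < Real.sqrt n := Real.sqrt_pos.2 (by exact_mod_cast hn)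
  have hs2 : Real.sqrt n ^ 2 = n := Real.sq_sqrt (by positivity)
  rw [div_eq_iff hs.ne'] at hc hc'
  have hcc : x * y * (x' * y') = c * c' * n := by
    rw [hc, hc']
    linear_combination (c * c' : ℝ) * hs2
  refine ⟨⟨a * b' + b * a' + 2 * (c * c' * n), ?_⟩,
    ⟨b * b' + ℓ ^ 2 * (a * a') + 2 * ℓ * (c * c' * n), ?_⟩,
    ⟨c * b' + ℓ * (a * c') + c' * b + ℓ * (a' * c), ?_⟩, ?_⟩
  · push_cast
    rw [← hcc, ← ha, ← hb, ← ha', ← hb']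
    ring
  · push_cast
    rw [← hcc, ← ha, ← hb, ← ha', ← hb']
    ring
  · rw [div_eq_iff hs.ne']
    push_cast
    rw [← ha, ← hb, ← ha', ← hb']
    linear_combination (y' ^ 2 + ℓ * x' ^ 2) * hc + (y ^ 2 + ℓ * x ^ 2) * hc'
  · have key : (y * y' + ℓ * (x * x')) ^ 2 - ℓ * (x * y' + y * x') ^ 2 =
        (y ^ 2 - ℓ * x ^ 2) * (y' ^ 2 - ℓ * x' ^ 2) := by ring
    rw [key]
    rcases hN with h | h <;> rcases hN' with h' | h' <;> simp [h, h']

theorem SnlParam.neg {n ℓ : ℕ} {x y : ℝ} (h : SnlParam n ℓ x y) : SnlParam n ℓ (-x) (-y) := by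
  simpa [SnlParam] using h

theorem SnlParam.conj {n ℓ : ℕ} {x y : ℝ} (h : SnlParam n ℓ x y) : SnlParam n ℓ (-x) y := by
  obtain ⟨ha, hb, ⟨c, hc⟩, hN⟩ := h
  exact ⟨by simpa using ha, hb, ⟨-c, by push_cast; rw [← hc]; ring⟩, by simpa using hN⟩

theorem SnlParam.zero_one (n ℓ : ℕ) : SnlParam n ℓ 0 1 :=
  ⟨⟨0, by simp⟩, ⟨1, by simp⟩, ⟨0, by simp⟩, by simp⟩

theorem SnlParam.ne_zero {n ℓ : ℕ} {x y : ℝ} (h : SnlParam n ℓ x y) :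
    y + Real.sqrt ℓ * x ≠ 0 := by
  intro h0
  have hs2 : Real.sqrt ℓ ^ 2 = ℓ := Real.sq_sqrt (by positivity)
  have : y ^ 2 - ℓ * x ^ 2 = 0 := by
    rw [← hs2]
    linear_combination (y - Real.sqrt ℓ * x) * h0
  rcases h.2.2.2 with h | h <;> rw [this] at h <;> norm_num at h

theorem SnlParam.three_halves_lt {n ℓ : ℕ} (hℓ : 1 < ℓ) {x y : ℝ} (h : SnlParam n ℓ x y)
    (hx : x ≠ 0) (h1 : 1 ≤ |y + Real.sqrt ℓ * x|) : 3 / 2 < |y + Real.sqrt ℓ * x| := by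
  obtain ⟨⟨a, ha⟩, -, -, hN⟩ := h
  have hs2 : Real.sqrt ℓ ^ 2 = ℓ := Real.sq_sqrt (by positivity)
  have hs0 : 0 ≤ Real.sqrt ℓ := Real.sqrt_nonneg _
  have hl : (2 : ℝ) ≤ ℓ := by exact_mod_cast hℓ
  have hs : 5 / 4 < Real.sqrt ℓ := by nlinarith
  have hx1 : 1 ≤ |x| := by
    have hpos : (0 : ℝ) < a := ha ▸ by positivity
    have hone : (1 : ℝ) ≤ a := by exact_mod_cast hpos
    rw [← one_le_sq_iff_one_le_abs, ha]
    exact hone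
  have hprod : |y + Real.sqrt ℓ * x| * |y - Real.sqrt ℓ * x| = 1 := by
    rw [← abs_mul]
    have : (y + Real.sqrt ℓ * x) * (y - Real.sqrt ℓ * x) = y ^ 2 - ℓ * x ^ 2 := by
      linear_combination -x ^ 2 * hs2
    rw [this]
    rcases hN with h | h <;> simp [h]
  have htri : 2 * (Real.sqrt ℓ * |x|) ≤ |y + Real.sqrt ℓ * x| + |y - Real.sqrt ℓ * x| := by
    have h := abs_sub (y + Real.sqrt ℓ * x) (y - Real.sqrt ℓ * x)
    have h2 : y + Real.sqrt ℓ * x - (y - Real.sqrt ℓ * x) = 2 * (Real.sqrt ℓ * x) := by ring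
    rwa [h2, abs_mul, abs_mul, abs_two, abs_of_nonneg hs0] at h
  have hconj : |y - Real.sqrt ℓ * x| ≤ 1 := by
    nlinarith [abs_nonneg (y - Real.sqrt ℓ * x)]
  nlinarith

theorem SnlParam.eq_of_zero {n ℓ : ℕ} {y : ℝ} (h : SnlParam n ℓ 0 y) : y = 1 ∨ y = -1 := by
  rcases h.2.2.2 with h | h
  · simpa using h
  · nlinarith [sq_nonneg y]

theorem SnlParam.exists_ne_zero {n ℓ : ℕ} (hn : 0 < n) (hℓ : 1 < ℓ)
    (hsq : ¬∃ k : ℕ, n * ℓ = k ^ 2) :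
    ∃ x y : ℝ, SnlParam n ℓ x y ∧ x ≠ 0 ∧ 1 ≤ |y + Real.sqrt ℓ * x| := by
  have hsq' : ¬IsSquare ((n * ℓ : ℕ) : ℤ) := by
    rw [Int.isSquare_natCast_iff]
    rintro ⟨k, hk⟩
    exact hsq ⟨k, by rw [hk, pow_two]⟩
  obtain ⟨z, w, hzw, hw⟩ := Pell.exists_of_not_isSquare
    (by exact_mod_cast Nat.mul_pos hn (by omega)) hsq'
  have hs : 0 < Real.sqrt n := Real.sqrt_pos.2 (by exact_mod_cast hn)
  have hs2 : Real.sqrt n ^ 2 = n := Real.sq_sqrt (by positivity)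
  have hN : (z : ℝ) ^ 2 - n * ℓ * (w : ℝ) ^ 2 = 1 := by exact_mod_cast hzw
  have hx : Real.sqrt n * |(w : ℝ)| ≠ 0 := by
    have : (w : ℝ) ≠ 0 := by exact_mod_cast hw
    positivity
  have hz1 : 1 ≤ |(z : ℝ)| := by
    rw [← one_le_sq_iff_one_le_abs]
    nlinarith [show (0 : ℝ) ≤ n * ℓ * (w : ℝ) ^ 2 by positivity]
  refine ⟨Real.sqrt n * |(w : ℝ)|, |(z : ℝ)|, ⟨⟨n * w ^ 2, ?_⟩, ⟨z ^ 2, ?_⟩, ⟨|w| * |z|, ?_⟩, ?_⟩,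
    hx, ?_⟩
  · push_cast
    rw [mul_pow, hs2, sq_abs]
  · push_cast
    rw [sq_abs]
  · rw [div_eq_iff hs.ne']
    push_cast
    ring
  · left
    rw [mul_pow, hs2, sq_abs, sq_abs, ← hN]
    ring
  · rw [abs_of_nonneg (by positivity)]
    have : 0 ≤ Real.sqrt ℓ * (Real.sqrt n * |(w : ℝ)|) := by positivity
    linarith

/-- `Snl n ℓ` as a subgroup of `GL(2, ℝ)`. -/
def SnlSubgroup (n ℓ : ℕ) (hn : 0 < n) : Subgroup (GL (Fin 2) ℝ) where
  carrier := {g | (g : Matrix (Fin 2) (Fin 2) ℝ) ∈ Snl n ℓ}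
  one_mem' := ⟨0, 1, (Pmat_zero_one ℓ).symm, SnlParam.zero_one n ℓ⟩
  mul_mem' := by
    rintro g g' ⟨x, y, hg, h⟩ ⟨x', y', hg', h'⟩
    exact ⟨_, _, by rw [Units.val_mul, hg, hg', Pmat_mul], SnlParam.mul hn h h'⟩
  inv_mem' := by
    rintro g ⟨x, y, hg, h⟩
    have hinv : ∀ x' y', (g : Matrix (Fin 2) (Fin 2) ℝ) * Pmat ℓ x' y' = 1 →
        ((g⁻¹ : GL (Fin 2) ℝ) : Matrix (Fin 2) (Fin 2) ℝ) = Pmat ℓ x' y' :=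
      fun x' y' h => Units.inv_eq_of_mul_eq_one_right h
    have hconj : SnlParam n ℓ (-x) y := SnlParam.conj h
    rcases h.2.2.2 with hN | hN
    · refine ⟨-x, y, hinv _ _ ?_, hconj⟩
      rw [hg, Pmat_mul, ← Pmat_zero_one ℓ]
      congr 1
      · ring
      · linear_combination hN
    · refine ⟨- -x, -y, hinv _ _ ?_, hconj.neg⟩
      rw [hg, Pmat_mul, ← Pmat_zero_one ℓ]
      congr 1
      · ring
      · linear_combination -hN

theorem exists_mem_SnlSubgroup {n ℓ : ℕ} (hn : 0 < n) {x y : ℝ} (h : SnlParam n ℓ x y) :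
    ∃ g ∈ SnlSubgroup n ℓ hn, (g : Matrix (Fin 2) (Fin 2) ℝ) = Pmat ℓ x y := by
  have hdet : (Pmat ℓ x y).det ≠ 0 := by
    rw [det_Pmat]
    rcases h.2.2.2 with h | h <;> rw [h] <;> norm_num
  exact ⟨Matrix.GeneralLinearGroup.mkOfDetNeZero _ hdet, ⟨x, y, rfl, h⟩, rfl⟩

/-- The homomorphism `P(x, y) ↦ log |y + x√ℓ|`. -/
noncomputable def SnlLog (n ℓ : ℕ) (hn : 0 < n) : SnlSubgroup n ℓ hn →* Multiplicative ℝ where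
  toFun g := Multiplicative.ofAdd (Real.log |g.1.1 1 1 + Real.sqrt ℓ * g.1.1 1 0|)
  map_one' := by simp
  map_mul' := by
    rintro ⟨g, x, y, hg, h⟩ ⟨g', x', y', hg', h'⟩
    have hs2 : Real.sqrt ℓ ^ 2 = ℓ := Real.sq_sqrt (by positivity)
    have hne : |y + Real.sqrt ℓ * x| ≠ 0 := abs_ne_zero.2 (SnlParam.ne_zero h)
    have hne' : |y' + Real.sqrt ℓ * x'| ≠ 0 := abs_ne_zero.2 (SnlParam.ne_zero h')
    rw [← ofAdd_add]
    congr 1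
    simp only [Subgroup.coe_mul, Units.val_mul, hg, hg', Pmat_mul]
    simp only [Pmat, Matrix.of_apply, Matrix.cons_val]
    rw [← Real.log_mul hne hne', ← abs_mul]
    congr 2
    linear_combination -(x * x') * hs2

theorem stmt_13 (n ℓ : ℕ) (hn : 0 < n) (hℓ : 1 < ℓ)
    (hsq : ¬∃ k : ℕ, n * ℓ = k ^ 2) :
    ∃ H : Subgroup (GL (Fin 2) ℝ),
      (fun g : GL (Fin 2) ℝ => (g : Matrix (Fin 2) (Fin 2) ℝ)) ''
          (H : Set (GL (Fin 2) ℝ)) = Snl n ℓ ∧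
      Nonempty (H ≃* Multiplicative (ℤ × ZMod 2)) := by
  refine ⟨SnlSubgroup n ℓ hn, ?_, ?_⟩
  · ext M
    constructor
    · rintro ⟨g, hg, rfl⟩
      exact hg
    · rintro ⟨x, y, rfl, h⟩
      exact exists_mem_SnlSubgroup hn h
  have hparam : ∀ g : SnlSubgroup n ℓ hn, ∃ x y, SnlParam n ℓ x y ∧ g.1.1 = Pmat ℓ x y ∧
      (SnlLog n ℓ hn g).toAdd = Real.log |y + Real.sqrt ℓ * x| := by
    rintro ⟨g, x, y, hg, h⟩
    exact ⟨x, y, h, hg, by simp [SnlLog, hg, Pmat]⟩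
  have hneg : -1 ∈ SnlSubgroup n ℓ hn :=
    ⟨-0, -1, by simp [Pmat, Matrix.one_fin_two], (SnlParam.zero_one n ℓ).neg⟩
  refine nonempty_mulEquiv_int_prod_zmod_two (SnlLog n ℓ hn) ⟨-1, hneg⟩ ?_ ?_ ?_ ?_ ?_
    (Real.log (3 / 2)) (Real.log_pos (by norm_num)) ?_ ?_
  · ext1
    simp
  · intro h
    have h00 := congrArg (fun g : SnlSubgroup n ℓ hn => g.1.1 0 0) h
    norm_num at h00
  · intro g
    ext1
    simp
  · intro g hg
    obtain ⟨x, y, h, hgM, hlog⟩ := hparam g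
    rw [hg, toAdd_one] at hlog
    have h1 : |y + Real.sqrt ℓ * x| = 1 :=
      Real.eq_one_of_pos_of_log_eq_zero (abs_pos.2 h.ne_zero) hlog.symm
    have hx : x = 0 := by
      by_contra hx
      have := h.three_halves_lt hℓ hx h1.ge
      norm_num [h1] at this
    subst hx
    rcases h.eq_of_zero with rfl | rfl
    · left
      ext1; ext1
      simp [hgM, Pmat, Matrix.one_fin_two]
    · right
      ext1; apply Units.ext
      simp [hgM, Pmat, Matrix.one_fin_two]
  · simp [SnlLog]
  · intro g hg
    obtain ⟨x, y, h, -, hlog⟩ := hparam g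
    rw [hlog] at hg ⊢
    have h1 : 1 < |y + Real.sqrt ℓ * x| := (Real.log_pos_iff (abs_nonneg _)).1 hg
    refine Real.log_le_log (by norm_num) (h.three_halves_lt hℓ ?_ h1.le).le
    rintro rfl
    rcases h.eq_of_zero with rfl | rfl <;> norm_num at h1
  · obtain ⟨x, y, h, hx, h1⟩ := SnlParam.exists_ne_zero hn hℓ hsq
    obtain ⟨g, hg, hgM⟩ := exists_mem_SnlSubgroup hn h
    refine ⟨⟨g, hg⟩, fun h0 => ?_⟩
    have hpos := Real.log_pos (lt_trans (by norm_num) (h.three_halves_lt hℓ hx h1))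
    have hlog : Real.log |y + Real.sqrt ℓ * x| = 0 := by
      simpa only [SnlLog, MonoidHom.coe_mk, OneHom.coe_mk, hgM, Pmat, Matrix.of_apply,
        Matrix.cons_val, ofAdd_eq_one] using h0
    exact hpos.ne' hlog
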